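/- Fix integers k ≥ 2 and p ≥ 1, and let (w_{1,n}, …, w_{p,n}) be independent F_k-valued random variables satisfying radial symmetry, positive drift, and subexponential growth. Then with probability going to 1 exponentially fast as n → ∞, the subgroup H = ⟨w_{1,n}, …, w_{p,n}⟩ is malnormal in F_k: for every g ∈ F_k, if gHg^{-1} ∩ H ≠ {1} then g ∈ H. -/

import Mathlib

open MeasureTheory

noncomputable section

/-- Every set of a free group is measurable (discrete σ-algebra). -/
instance freeGroupMeasurableSpace {α : Type*} : MeasurableSpace (FreeGroup α) := ⊤

/-- The length `|g|` of the reduced word representing `g`. -/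
def wlen {k : ℕ} (g : FreeGroup (Fin k)) : ℕ := (FreeGroup.toWord g).length

/-- A family of "failure probabilities" decays exponentially: the corresponding events
hold with probability going to 1 exponentially fast as `n → ∞`. -/
def ExpDecay (f : ℕ → ENNReal) : Prop :=
  ∃ C : ℝ, 0 < C ∧ ∃ κ : ℝ, 1 < κ ∧ ∀ n : ℕ, f n ≤ ENNReal.ofReal (C / κ ^ n)

/-- A subgroup `H` is malnormal: for every `g`, if `gHg⁻¹ ∩ H ≠ {1}` then `g ∈ H`. -/
def Malnormal {k : ℕ} (H : Subgroup (FreeGroup (Fin k))) : Prop :=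
  ∀ g : FreeGroup (Fin k),
    (∃ x : FreeGroup (Fin k), x ≠ 1 ∧ x ∈ H ∧ g⁻¹ * x * g ∈ H) → g ∈ H

lemma isReduced_of_append {α : Type*} {U V : List (α × Bool)}
    (h : FreeGroup.IsReduced (U ++ V)) : FreeGroup.IsReduced U ∧ FreeGroup.IsReduced V :=
  ⟨(List.isChain_append.1 h).1, (List.isChain_append.1 h).2.1⟩

open FreeGroup in
/-- Concatenating two reduced words cancels a maximal common part. -/
lemma exists_cancellation {α : Type*} [DecidableEq α] (A B : List (α × Bool))
    (hA : IsReduced A) (hB : IsReduced B) :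
    ∃ A' C B', A = A' ++ invRev C ∧ B = C ++ B' ∧ reduce (A ++ B) = A' ++ B' := by
  induction B generalizing A with
  | nil => exact ⟨A, [], [], by simp, by simp, by simpa using hA.reduce_eq⟩
  | cons y B ih =>
    rcases List.eq_nil_or_concat A with rfl | ⟨A₀, x, rfl⟩
    · exact ⟨[], [], y :: B, by simp, by simp, by simpa using hB.reduce_eq⟩
    · by_cases hxy : x.1 = y.1 ∧ x.2 = !y.2
      · obtain ⟨A', C, B', h1, h2, h3⟩ := ih A₀
          (isReduced_of_append (List.concat_eq_append ▸ hA)).1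
          (isReduced_of_append (U := [y]) hB).2
        refine ⟨A', y :: C, B', ?_, by simp [h2], ?_⟩
        · rw [h1, invRev_cons]
          have : x = (y.1, !y.2) := Prod.ext hxy.1 hxy.2
          simp [this, invRev]
        · rw [← h3]
          apply reduce.Step.eq
          have : x = (y.1, !y.2) := Prod.ext hxy.1 hxy.2
          have h := @Red.Step.not _ A₀ B y.1 (!y.2)
          simpa [this] using h
      · refine ⟨A₀ ++ [x], [], y :: B, by simp, by simp, ?_⟩
        simp only [List.concat_eq_append] at hA ⊢
        apply IsReduced.reduce_eq
        have h2 : IsReduced ([x] ++ y :: B) := by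
          simp only [List.singleton_append, isReduced_cons_cons]
          refine ⟨fun h => ?_, hB⟩
          by_contra h'
          exact hxy ⟨h, by cases h3 : x.2 <;> cases h4 : y.2 <;> simp_all⟩
        simpa using hA.append_overlap h2 (by simp)

section Overlap

variable {α ι : Type*} [DecidableEq α]

/-- The generator `w i` or its inverse, according to the sign. -/
def signedGen (w : ι → FreeGroup α) (e : ι × Bool) : FreeGroup α :=
  if e.2 then w e.1 else (w e.1)⁻¹

/-- The reduced word of a signed generator. -/
def signedWord (w : ι → FreeGroup α) (e : ι × Bool) : List (α × Bool) :=
  (signedGen w e).toWord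

/-- Words of length `m` occur at most once in the signed generators. -/
def UniqueSubwords (w : ι → FreeGroup α) (m : ℕ) : Prop :=
  ∀ e f a b, a + m ≤ (signedWord w e).length → b + m ≤ (signedWord w f).length →
    (∀ j < m, (signedWord w e)[a + j]? = (signedWord w f)[b + j]?) → e = f ∧ a = b

/-- The subword of `X` of length `n` at position `s` is read along a translate, by an element of
the subgroup generated by `w`, of the path labelled by a signed generator. -/
def TracesAt (w : ι → FreeGroup α) (X : List (α × Bool)) (s n : ℕ) : Prop :=
  s + n ≤ X.length ∧ ∃ h ∈ Subgroup.closure (Set.range w), ∃ e a,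
    a + n ≤ (signedWord w e).length ∧
    FreeGroup.mk (X.take s) = h * FreeGroup.mk ((signedWord w e).take a) ∧
    ∀ j < n, X[s + j]? = (signedWord w e)[a + j]?

/-- Every position of `X` is followed within distance `M` by the end of `X` or by a traced subword
of length `M`. -/
def Covered (w : ι → FreeGroup α) (M : ℕ) (X : List (α × Bool)) : Prop :=
  ∀ s < X.length, ∃ s', s ≤ s' ∧ s' < s + M ∧ (s' = X.length ∨ TracesAt w X s' M)

lemma mk_take_add {β : Type*} (X : List (β × Bool)) (s d : ℕ) :
    FreeGroup.mk (X.take (s + d)) =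
      FreeGroup.mk (X.take s) * FreeGroup.mk ((X.drop s).take d) := by
  rw [List.take_add, FreeGroup.mul_mk]

lemma take_drop_eq_of_getElem? {β : Type*} {X Y : List β} {s t n d : ℕ} (hd : d ≤ n)
    (h : ∀ j < n, X[s + j]? = Y[t + j]?) : (X.drop s).take d = (Y.drop t).take d := by
  apply List.ext_getElem?
  intro j
  by_cases hj : j < d
  · simp [hj, h j (by omega)]
  · simp [hj]

lemma TracesAt.shift {w : ι → FreeGroup α} {X : List (α × Bool)} {s n d n' : ℕ}
    (hX : TracesAt w X s n) (hd : d + n' ≤ n) : TracesAt w X (s + d) n' := by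
  obtain ⟨hs, h, hh, e, a, ha, hmk, hl⟩ := hX
  refine ⟨by omega, h, hh, e, a + d, by omega, ?_, fun j hj => ?_⟩
  · rw [mk_take_add, mk_take_add, hmk, take_drop_eq_of_getElem? (by omega) hl, mul_assoc]
  · simpa [add_assoc] using hl (d + j) (by omega)

lemma TracesAt.append {w : ι → FreeGroup α} {X : List (α × Bool)} {s n : ℕ}
    (hX : TracesAt w X s n) (T : List (α × Bool)) : TracesAt w (X ++ T) s n := by
  obtain ⟨hs, h, hh, e, a, ha, hmk, hl⟩ := hX
  refine ⟨by simp; omega, h, hh, e, a, ha, ?_, fun j hj => ?_⟩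
  · rw [List.take_append_of_le_length (by omega), hmk]
  · rw [List.getElem?_append_left (by omega), hl j hj]

lemma Covered.append {w : ι → FreeGroup α} {Z T : List (α × Bool)} {M : ℕ}
    (hZ : Covered w M Z) (hM : 0 < M) (hT : M ≤ T.length)
    (h : TracesAt w (Z ++ T) Z.length T.length) :
    Covered w M (Z ++ T) := by
  intro s hs
  rw [List.length_append] at hs
  by_cases hsZ : s < Z.length
  · obtain ⟨s', h1, h2, rfl | h3⟩ := hZ s hsZ
    · exact ⟨_, h1, h2, .inr (by simpa using h.shift (d := 0) (by omega))⟩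
    · exact ⟨s', h1, h2, .inr (h3.append T)⟩
  · by_cases hsM : s + M ≤ Z.length + T.length
    · have h4 := h.shift (d := s - Z.length) (n' := M) (by omega)
      rw [Nat.add_sub_cancel' (by omega)] at h4
      exact ⟨s, le_rfl, by omega, .inr h4⟩
    · exact ⟨Z.length + T.length, by omega, by omega, .inl (by simp)⟩

lemma signedGen_mem_closure {β : Type*} (w : ι → FreeGroup β) (e : ι × Bool) :
    signedGen w e ∈ Subgroup.closure (Set.range w) := by
  have := Subgroup.subset_closure (Set.mem_range_self (f := w) e.1)
  unfold signedGen
  split_ifs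
  · exact this
  · exact inv_mem this

lemma signedWord_not (w : ι → FreeGroup α) (i : ι) (b : Bool) :
    signedWord w (i, !b) = FreeGroup.invRev (signedWord w (i, b)) := by
  cases b <;> simp [signedWord, signedGen, FreeGroup.toWord_inv, FreeGroup.invRev_invRev]

lemma length_signedWord (w : ι → FreeGroup α) (e : ι × Bool) :
    (signedWord w e).length = (w e.1).toWord.length := by
  unfold signedWord signedGen
  split_ifs <;> simp [FreeGroup.toWord_inv]

lemma exists_cover_of_isReduced {w : ι → FreeGroup α} {m M : ℕ} (hm : 0 < m) (hM : 0 < M)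
    (hw : UniqueSubwords w m) (hlen : ∀ i, 2 * m + M ≤ (w i).toWord.length)
    (v : List (ι × Bool)) (e : ι × Bool) (hv : FreeGroup.IsReduced (v ++ [e])) :
    ∃ Z c, c < m ∧ ((v ++ [e]).map (signedGen w)).prod.toWord = Z ++ (signedWord w e).drop c ∧
      Covered w M Z ∧ ∃ h ∈ Subgroup.closure (Set.range w),
        FreeGroup.mk Z = h * FreeGroup.mk ((signedWord w e).take c) := by
  induction v using List.reverseRecOn generalizing e with
  | nil =>
    refine ⟨[], 0, hm, by simp [signedWord], fun s hs => by simp at hs, 1, one_mem _, by simp⟩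
  | append_singleton v f ih =>
    obtain ⟨Z, c, hc, hword, hcov, h, hh, hmk⟩ := ih f
      (isReduced_of_append hv).1
    have hfe : f.1 = e.1 → f.2 = e.2 := by
      have := (isReduced_of_append (U := v) (V := [f, e]) (by simpa using hv)).2
      simpa using this
    set g := ((v ++ [f]).map (signedGen w)).prod with hg
    have hprod : ((v ++ [f] ++ [e]).map (signedGen w)).prod = g * signedGen w e := by
      rw [hg, List.map_append (l₂ := [e]), List.prod_append]; simp
    obtain ⟨A', C, B', hA, hB, hAB⟩ := exists_cancellation g.toWord (signedWord w e)
      FreeGroup.isReduced_toWord FreeGroup.isReduced_toWord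
    have hlf := length_signedWord w f
    have hle := length_signedWord w e
    have h1 := hlen f.1
    have h2 := hlen e.1
    have hCm : C.length < m := by
      by_contra hCm
      push Not at hCm
      have h3 := congrArg FreeGroup.invRev (hword.symm.trans hA)
      rw [FreeGroup.invRev_append, FreeGroup.invRev_append, FreeGroup.invRev_invRev] at h3
      have h5 : ∀ j < m, (signedWord w (f.1, !f.2))[0 + j]? = (signedWord w e)[0 + j]? := by
        intro j hj
        rw [signedWord_not, hB, List.getElem?_append_left (by omega),
          ← List.take_append_drop c (signedWord w (f.1, f.2)), FreeGroup.invRev_append,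
          List.getElem?_append_left (by simp; omega),
          ← List.getElem?_append_left (l₁ := C) (l₂ := FreeGroup.invRev A') (by omega), ← h3,
          List.getElem?_append_left (by simp; omega)]
      have h6 := (hw _ _ 0 0 (by rw [length_signedWord]; simp; omega) (by omega) h5).1
      rw [← h6] at hfe
      simp at hfe
    have hgH : g ∈ Subgroup.closure (Set.range w) := by
      refine list_prod_mem fun x hx => ?_
      obtain ⟨e', -, rfl⟩ := List.mem_map.1 hx
      exact signedGen_mem_closure w e'
    have hlen' := congrArg List.length (hword.symm.trans hA)
    simp only [List.length_append, List.length_drop, FreeGroup.invRev_length] at hlen'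
    obtain ⟨T, hT, hT'⟩ : ∃ T, A' = Z ++ T ∧
        (signedWord w f).drop c = T ++ FreeGroup.invRev C := by
      rcases List.append_eq_append_iff.1 (hword.symm.trans hA) with ⟨T, h3, h4⟩ | ⟨T, h3, h4⟩
      · exact ⟨T, h3, h4⟩
      · have h5 := congrArg List.length h3
        simp only [List.length_append] at h5
        omega
    have hTl := congrArg List.length hT'
    simp only [List.length_append, List.length_drop, FreeGroup.invRev_length] at hTl
    refine ⟨A', C.length, hCm, ?_, ?_, g, hgH, ?_⟩
    · rw [hprod, FreeGroup.toWord_mul]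
      conv_rhs => rw [hB, List.drop_left]
      exact hAB
    · rw [hT]
      refine hcov.append hM (by omega) ⟨by simp, h, hh, f, c, by omega, by simpa using hmk, ?_⟩
      intro j hj
      rw [List.getElem?_append_right (by omega), Nat.add_sub_cancel_left, ← List.getElem?_drop, hT',
        List.getElem?_append_left hj]
    · have h3 : g = FreeGroup.mk A' * (FreeGroup.mk C)⁻¹ := by
        rw [FreeGroup.inv_mk, FreeGroup.mul_mk, ← hA, FreeGroup.mk_toWord]
      rw [h3]
      rw [hB, List.take_left]
      exact (inv_mul_cancel_right _ _).symm

lemma covered_toWord_of_mem_closure {w : ι → FreeGroup α} {m M : ℕ} (hm : 0 < m) (hM : 0 < M)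
    (hw : UniqueSubwords w m) (hlen : ∀ i, 2 * m + M ≤ (w i).toWord.length)
    {x : FreeGroup α} (hx : x ∈ Subgroup.closure (Set.range w)) : Covered w M x.toWord := by
  classical
  rw [← FreeGroup.range_lift_eq_closure] at hx
  obtain ⟨v, rfl⟩ := hx
  have hv : FreeGroup.lift w v = (v.toWord.map (signedGen w)).prod := by
    conv_lhs => rw [← FreeGroup.mk_toWord (x := v)]
    rw [FreeGroup.lift_mk]
    congr 2
    ext e : 1
    rcases e with ⟨i, _ | _⟩ <;> simp [signedGen]
  rcases List.eq_nil_or_concat v.toWord with h | ⟨l, e, h⟩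
  · rw [hv, h]
    intro s hs
    simp at hs
  · have hred := FreeGroup.isReduced_toWord (x := v)
    rw [h, List.concat_eq_append] at hred
    obtain ⟨Z, c, hc, hword, hcov, h', hh, hmk⟩ :=
      exists_cover_of_isReduced hm hM hw hlen l e hred
    rw [hv, h, List.concat_eq_append, hword]
    have h1 := length_signedWord w e
    have h2 := hlen e.1
    refine hcov.append hM (by rw [List.length_drop]; omega)
      ⟨by simp, h', hh, e, c, by rw [List.length_drop]; omega, by simpa using hmk, ?_⟩
    intro j hj
    rw [List.getElem?_append_right (by omega), Nat.add_sub_cancel_left, List.getElem?_drop]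

lemma exists_length_toWord_pow_lt [Finite α] {x : FreeGroup α} (hx : x ≠ 1) (B : ℕ) :
    ∃ N : ℕ, B < (x ^ N).toWord.length := by
  by_contra! h
  have hinj : Function.Injective fun N : ℕ => (x ^ N).toWord :=
    FreeGroup.toWord_injective.comp (IsMulTorsionFree.pow_right_injective hx)
  exact Set.infinite_range_of_injective hinj
    ((List.finite_length_le (α × Bool) B).subset (by rintro _ ⟨N, rfl⟩; exact h N))

/-- If long subwords of the generators are unique then the subgroup they generate is malnormal. -/
theorem mem_closure_of_uniqueSubwords [Finite α] {w : ι → FreeGroup α} {m : ℕ} (hm : 0 < m)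
    (hw : UniqueSubwords w m) (hlen : ∀ i, 5 * m ≤ (w i).toWord.length)
    {g x : FreeGroup α} (hx1 : x ≠ 1) (hx : x ∈ Subgroup.closure (Set.range w))
    (hgx : g⁻¹ * x * g ∈ Subgroup.closure (Set.range w)) :
    g ∈ Subgroup.closure (Set.range w) := by
  obtain ⟨N, hN⟩ := exists_length_toWord_pow_lt hx1 (2 * g.toWord.length + 5 * m)
  set X := (x ^ N).toWord with hX
  have hyN : g⁻¹ * x ^ N * g ∈ Subgroup.closure (Set.range w) := by
    have h := pow_mem hgx N
    rwa [show g⁻¹ * x * g = g⁻¹ * x * g⁻¹⁻¹ by simp, conj_pow, inv_inv] at h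
  set y := g⁻¹ * x ^ N * g with hy
  have hcX : Covered w (3 * m) X := covered_toWord_of_mem_closure hm (by omega) hw
    (fun i => by have := hlen i; omega) (pow_mem hx N)
  have hcY : Covered w m y.toWord := covered_toWord_of_mem_closure hm hm hw
    (fun i => by have := hlen i; omega) hyN
  obtain ⟨G', C, Y', hG, hY, hGY⟩ := exists_cancellation g.toWord y.toWord
    FreeGroup.isReduced_toWord FreeGroup.isReduced_toWord
  obtain ⟨X', D, G'', hX', hG'', hXG⟩ := exists_cancellation X g.toWord
    FreeGroup.isReduced_toWord FreeGroup.isReduced_toWord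
  have heq : G' ++ Y' = X' ++ G'' := by
    rw [← hGY, ← hXG, hX, ← FreeGroup.toWord_mul, ← FreeGroup.toWord_mul, hy]
    congr 1
    group
  have l1 := congrArg List.length hG
  have l2 := congrArg List.length hY
  have l3 := congrArg List.length hX'
  have l4 := congrArg List.length hG''
  have l5 := congrArg List.length heq
  simp only [List.length_append, FreeGroup.invRev_length] at l1 l2 l3 l4 l5
  have hbase : FreeGroup.mk (X.take G'.length) = g * FreeGroup.mk (y.toWord.take C.length) := by
    have h1 : X.take G'.length = G' := by
      rw [hX', List.take_append_of_le_length (by omega),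
        ← List.take_append_of_le_length (l₂ := G'') (by omega), ← heq, List.take_left]
    have h2 : g = FreeGroup.mk G' * (FreeGroup.mk C)⁻¹ := by
      rw [FreeGroup.inv_mk, FreeGroup.mul_mk, ← hG, FreeGroup.mk_toWord]
    rw [h1, hY, List.take_left, h2]
    exact (inv_mul_cancel_right _ _).symm
  have hagree : ∀ j < X'.length - G'.length, X[G'.length + j]? = y.toWord[C.length + j]? := by
    intro j hj
    rw [hX', List.getElem?_append_left (by omega),
      ← List.getElem?_append_left (l₂ := G'') (by omega), ← heq,
      List.getElem?_append_right (by omega), hY, List.getElem?_append_right (by omega)]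
    simp
  obtain ⟨s', hs1, hs2, hs3⟩ := hcX G'.length (by omega)
  obtain ⟨d, rfl⟩ := Nat.exists_eq_add_of_le hs1
  replace hs3 := hs3.resolve_left (by omega)
  obtain ⟨t', ht1, ht2, ht3⟩ := hcY (C.length + d) (by omega)
  obtain ⟨d', rfl⟩ := Nat.exists_eq_add_of_le ht1
  obtain ⟨htl, h', hh', f, b, hb, hmkY, hYl⟩ := ht3.resolve_left (by omega)
  obtain ⟨hsl, h, hh, e, a, ha, hmkX, hXl⟩ := hs3.shift (d := d') (n' := m) (by omega)
  obtain ⟨rfl, rfl⟩ := hw e f a b ha hb fun j hj => by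
    rw [← hXl j hj, ← hYl j hj]
    simpa [add_assoc] using hagree (d + d' + j) (by omega)
  have hmk : FreeGroup.mk (X.take (G'.length + d + d')) =
      g * FreeGroup.mk (y.toWord.take (C.length + d + d')) := by
    rw [add_assoc, add_assoc, mk_take_add, mk_take_add _ C.length, hbase, mul_assoc,
      take_drop_eq_of_getElem? (by omega) hagree]
  rw [hmkX, hmkY, ← mul_assoc] at hmk
  rw [show g = h * h'⁻¹ by rw [eq_mul_inv_iff_mul_eq, mul_right_cancel hmk]]
  exact mul_mem hh (inv_mem hh')

end Overlap

section Occurrences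

variable {α ι : Type*}

/-- The inverse of a letter. -/
def letterInv (x : α × Bool) : α × Bool := (x.1, !x.2)

lemma letterInv_letterInv (x : α × Bool) : letterInv (letterInv x) = x := by simp [letterInv]

lemma letterInv_injective : Function.Injective (letterInv : α × Bool → α × Bool) :=
  Function.LeftInverse.injective letterInv_letterInv

lemma getElem?_invRev {U : List (α × Bool)} {i : ℕ} (hi : i < U.length) :
    (FreeGroup.invRev U)[i]? = (U[U.length - 1 - i]?).map letterInv := by
  rw [FreeGroup.invRev, List.getElem?_reverse (by simpa), List.getElem?_map, List.length_map]
  rfl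

/-- The subwords of length `m` of `U` at `a` and of `V` at `b` agree. -/
def SameAt (m a b : ℕ) (U V : List (α × Bool)) : Prop :=
  a + m ≤ U.length ∧ b + m ≤ V.length ∧ ∀ x < m, U[a + x]? = V[b + x]?

/-- The subwords of length `m` of `U` at `a` and of `V` at `b` are mutually inverse. -/
def OppositeAt (m a b : ℕ) (U V : List (α × Bool)) : Prop :=
  a + m ≤ U.length ∧ b + m ≤ V.length ∧ ∀ x < m, U[a + x]? = (V[b + (m - 1 - x)]?).map letterInv

lemma uniqueSubwords_of [DecidableEq α] {w : ι → FreeGroup α} {m : ℕ}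
    (hs : ∀ i j a b, SameAt m a b (w i).toWord (w j).toWord → i = j ∧ a = b)
    (ho : ∀ i j a b, ¬ OppositeAt m a b (w i).toWord (w j).toWord) : UniqueSubwords w m := by
  have hword : ∀ i, signedWord w (i, true) = (w i).toWord := fun i => by
    simp [signedWord, signedGen]
  have hword' : ∀ i, signedWord w (i, false) = FreeGroup.invRev (w i).toWord := fun i => by
    simp [signedWord, signedGen, FreeGroup.toWord_inv]
  rintro ⟨i, _ | _⟩ ⟨j, _ | _⟩ a b ha hb h <;>
    simp only [hword, hword', FreeGroup.invRev_length] at ha hb h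
  · set A := (w i).toWord.length
    set B := (w j).toWord.length
    obtain ⟨h1, h2⟩ := hs i j (A - a - m) (B - b - m) ⟨by omega, by omega, fun x hx => by
      have h3 := h (m - 1 - x) (by omega)
      rw [getElem?_invRev (by omega), getElem?_invRev (by omega)] at h3
      have h4 := Option.map_injective letterInv_injective h3
      convert h4 using 2 <;> omega⟩
    subst h1
    exact ⟨rfl, by omega⟩
  · set A := (w i).toWord.length
    refine (ho j i b (A - a - m) ⟨hb, by omega, fun x hx => ?_⟩).elim
    rw [← h x hx, getElem?_invRev (by omega)]
    congr 2
    omega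
  · set B := (w j).toWord.length
    refine (ho i j a (B - b - m) ⟨ha, by omega, fun x hx => ?_⟩).elim
    rw [h x hx, getElem?_invRev (by omega)]
    congr 2
    omega
  · obtain ⟨rfl, rfl⟩ := hs i j a b ⟨ha, hb, h⟩
    exact ⟨rfl, rfl⟩

/-- A reduced word does not overlap its own inverse. -/
lemma OppositeAt.disjoint {m a b : ℕ} {U : List (α × Bool)} (hU : FreeGroup.IsReduced U)
    (hm : 0 < m) (h : OppositeAt m a b U U) : a + m ≤ b ∨ b + m ≤ a := by
  by_contra! hcon
  obtain ⟨ha, hb, h⟩ := h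
  obtain ⟨c, hc | hc⟩ := Nat.even_or_odd' (a + b + m - 1)
  · have h1 := h (c - a) (by omega)
    rw [show a + (c - a) = c by omega, show b + (m - 1 - (c - a)) = c by omega,
      List.getElem?_eq_getElem (by omega)] at h1
    simp [letterInv, Prod.ext_iff] at h1
  · have h1 := h (c - a) (by omega)
    rw [show a + (c - a) = c by omega, show b + (m - 1 - (c - a)) = c + 1 by omega,
      List.getElem?_eq_getElem (by omega), List.getElem?_eq_getElem (by omega)] at h1
    simp only [letterInv, Option.map_some, Option.some.injEq, Prod.ext_iff] at h1
    have h2 := List.isChain_iff_getElem.1 hU c (by omega) h1.1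
    simp [h2] at h1

/-- Two words which agree outside the window `[b, b + m)`. -/
def AgreeOutside (b m : ℕ) (U V : List (α × Bool)) : Prop :=
  ∀ x, x < b ∨ b + m ≤ x → U[x]? = V[x]?

lemma AgreeOutside.eq {b m : ℕ} {U V : List (α × Bool)} (h : AgreeOutside b m U V)
    (hw : ∀ x < m, U[b + x]? = V[b + x]?) : U = V := by
  apply List.ext_getElem?
  intro x
  by_cases hx : x < b ∨ b + m ≤ x
  · exact h x hx
  · have := hw (x - b) (by omega)
    rwa [show b + (x - b) = x by omega] at this

lemma SameAt.eq_of_agreeOutside {m a b : ℕ} {T U V : List (α × Bool)} (hU : SameAt m a b T U)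
    (hV : SameAt m a b T V) (h : AgreeOutside b m U V) : U = V :=
  h.eq fun x hx => by rw [← hU.2.2 x hx, hV.2.2 x hx]

lemma OppositeAt.eq_of_agreeOutside {m a b : ℕ} {T U V : List (α × Bool)}
    (hU : OppositeAt m a b T U) (hV : OppositeAt m a b T V) (h : AgreeOutside b m U V) : U = V :=
  h.eq fun x hx => by
    have h1 := (hU.2.2 (m - 1 - x) (by omega)).symm.trans (hV.2.2 (m - 1 - x) (by omega))
    rw [show m - 1 - (m - 1 - x) = x by omega] at h1
    exact Option.map_injective letterInv_injective h1

lemma SameAt.eq_of_agreeOutside_self {m a b : ℕ} {U V : List (α × Bool)} (hab : a < b)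
    (hU : SameAt m a b U U) (hV : SameAt m a b V V) (h : AgreeOutside b m U V) : U = V := by
  apply List.ext_getElem?
  intro x
  induction x using Nat.strong_induction_on with
  | _ x ih =>
    by_cases hx : x < b ∨ b + m ≤ x
    · exact h x hx
    · have h1 := hU.2.2 (x - b) (by omega)
      have h2 := hV.2.2 (x - b) (by omega)
      rw [show b + (x - b) = x by omega] at h1 h2
      rw [← h1, ← h2]
      exact ih _ (by omega)

lemma OppositeAt.eq_of_agreeOutside_self {m a b : ℕ} {U V : List (α × Bool)}
    (hab : a + m ≤ b ∨ b + m ≤ a) (hU : OppositeAt m a b U U) (hV : OppositeAt m a b V V)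
    (h : AgreeOutside b m U V) : U = V :=
  h.eq fun x hx => by
    have h1 := hU.2.2 (m - 1 - x) (by omega)
    have h2 := hV.2.2 (m - 1 - x) (by omega)
    rw [show m - 1 - (m - 1 - x) = x by omega] at h1 h2
    exact Option.map_injective letterInv_injective
      (h1.symm.trans ((h _ (by omega)).trans h2))

end Occurrences

section Counting

variable (α : Type*) [Fintype α]

open Classical in
/-- The reduced words of length `n`. -/
def reducedWords (n : ℕ) : Finset (List (α × Bool)) :=
  (List.finite_length_eq (α × Bool) n).toFinset.filter FreeGroup.IsReduced

variable {α}

lemma mem_reducedWords {n : ℕ} {U : List (α × Bool)} :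
    U ∈ reducedWords α n ↔ U.length = n ∧ FreeGroup.IsReduced U := by
  simp [reducedWords]

lemma card_reducedWords_zero : (reducedWords α 0).card = 1 := by
  rw [Finset.card_eq_one]
  exact ⟨[], by ext U; simp only [mem_reducedWords, Finset.mem_singleton, List.length_eq_zero_iff]
                constructor
                · exact And.left
                · rintro rfl; simp⟩

lemma card_reducedWords_one : (reducedWords α 1).card = 2 * Fintype.card α := by
  classical
  have : reducedWords α 1 = Finset.univ.image fun x : α × Bool => [x] := by
    ext U
    simp only [mem_reducedWords, Finset.mem_image, Finset.mem_univ, true_and,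
      List.length_eq_one_iff]
    constructor
    · rintro ⟨⟨x, rfl⟩, -⟩; exact ⟨x, rfl⟩
    · rintro ⟨x, rfl⟩; exact ⟨⟨x, rfl⟩, .singleton⟩
  rw [this, Finset.card_image_of_injective _ (fun x y h => by simpa using h)]
  simp [mul_comm]

lemma card_reducedWords_add_two (n : ℕ) : (reducedWords α (n + 2)).card =
    (2 * Fintype.card α - 1) * (reducedWords α (n + 1)).card := by
  classical
  have hmaps : ∀ U ∈ reducedWords α (n + 2), U.tail ∈ reducedWords α (n + 1) := by
    intro U hU
    rw [mem_reducedWords] at hU ⊢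
    exact ⟨by simp [hU.1], List.IsChain.tail hU.2⟩
  rw [Finset.card_eq_sum_card_fiberwise hmaps, Finset.sum_const_nat (m := 2 * Fintype.card α - 1),
    mul_comm]
  intro V hV
  rw [mem_reducedWords] at hV
  obtain ⟨y, T, rfl⟩ := List.exists_cons_of_length_eq_add_one hV.1
  have : (reducedWords α (n + 2)).filter (fun U => U.tail = y :: T) =
      (Finset.univ.erase (letterInv y)).image fun x => x :: y :: T := by
    ext U
    simp only [Finset.mem_filter, mem_reducedWords, Finset.mem_image, Finset.mem_erase,
      Finset.mem_univ, and_true]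
    constructor
    · rintro ⟨⟨h1, h2⟩, h3⟩
      obtain ⟨x, S, rfl⟩ := List.exists_cons_of_length_eq_add_one h1
      obtain rfl : S = y :: T := h3
      refine ⟨x, ?_, rfl⟩
      rintro rfl
      simp [letterInv] at h2
    · rintro ⟨x, hx, rfl⟩
      refine ⟨⟨by simpa using hV.1, FreeGroup.isReduced_cons_cons.2 ⟨fun h => ?_, hV.2⟩⟩, rfl⟩
      by_contra h'
      exact hx (Prod.ext h (by cases h3 : x.2 <;> cases h4 : y.2 <;> simp_all [letterInv]))
  rw [this, Finset.card_image_of_injective _ (fun x y h => by simpa using h),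
    Finset.card_erase_of_mem (Finset.mem_univ _)]
  simp [mul_comm]

lemma card_reducedWords_succ (n : ℕ) : (reducedWords α (n + 1)).card =
    2 * Fintype.card α * (2 * Fintype.card α - 1) ^ n := by
  induction n with
  | zero => simp [card_reducedWords_one]
  | succ n ih => rw [card_reducedWords_add_two, ih]; ring

lemma card_reducedWords_mul_le (n : ℕ) :
    (reducedWords α n).card * (2 * Fintype.card α - 1) ≤
      2 * Fintype.card α * (2 * Fintype.card α - 1) ^ n := by
  cases n with
  | zero => rw [card_reducedWords_zero]; simp
  | succ n => rw [card_reducedWords_succ, pow_succ, mul_assoc]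

/-- If the words of `F` are determined by what is outside a window of length `m`, then `F` makes up
a proportion at most `2 / (2k - 1) ^ m` of the reduced words. -/
lemma card_mul_pow_le [Nonempty α] {F : Finset (List (α × Bool))} {b m l : ℕ} (hm : 0 < m)
    (hF : F ⊆ reducedWords α l) (hl : b + m ≤ l)
    (hinj : ∀ U ∈ F, ∀ V ∈ F, AgreeOutside b m U V → U = V) :
    F.card * (2 * Fintype.card α - 1) ^ m ≤ 2 * (reducedWords α l).card := by
  have h1 : F.card ≤ (reducedWords α b).card * (reducedWords α (l - (b + m))).card := by
    rw [← Finset.card_product]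
    refine Finset.card_le_card_of_injOn (fun U => (U.take b, U.drop (b + m))) ?_ ?_
    · intro U hU
      have h2 := mem_reducedWords.1 (hF hU)
      simp only [Finset.coe_product, Set.mem_prod, Finset.mem_coe, mem_reducedWords]
      exact ⟨⟨by simp; omega, List.IsChain.take h2.2 _⟩,
        ⟨by simp [h2.1], List.IsChain.drop h2.2 _⟩⟩
    · intro U hU V hV h
      refine hinj U hU V hV fun x hx => ?_
      obtain ⟨h3, h4⟩ := Prod.ext_iff.1 h
      rcases hx with hx | hx
      · have := congrArg (·[x]?) h3
        simpa [hx] using this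
      · have := congrArg (·[x - (b + m)]?) h4
        simpa [hx] using this
  obtain ⟨r, rfl⟩ := Nat.exists_eq_add_of_le hl
  obtain ⟨l', hl'⟩ : ∃ l', b + m + r = l' + 1 := ⟨b + m + r - 1, by omega⟩
  have hk : 0 < Fintype.card α := Fintype.card_pos
  have hb := card_reducedWords_mul_le (α := α) b
  have hr := card_reducedWords_mul_le (α := α) r
  have hc := card_reducedWords_succ (α := α) l'
  rw [Nat.add_sub_cancel_left] at h1
  rw [hl', hc]
  obtain ⟨q, hq⟩ : ∃ q, 2 * Fintype.card α = q + 2 := ⟨2 * Fintype.card α - 2, by omega⟩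
  simp only [hq, show q + 2 - 1 = q + 1 by omega] at hb hr ⊢
  have hq2 : 0 < (q + 1) ^ 2 := by positivity
  refine Nat.le_of_mul_le_mul_right ?_ hq2
  calc F.card * (q + 1) ^ m * (q + 1) ^ 2
      ≤ ((reducedWords α b).card * (reducedWords α r).card) * (q + 1) ^ m * (q + 1) ^ 2 := by gcongr
    _ = ((reducedWords α b).card * (q + 1)) * ((reducedWords α r).card * (q + 1)) *
          (q + 1) ^ m := by ring
    _ ≤ ((q + 2) * (q + 1) ^ b) * ((q + 2) * (q + 1) ^ r) * (q + 1) ^ m := by gcongr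
    _ = (q + 2) * (q + 2) * (q + 1) ^ (b + m + r) := by ring
    _ ≤ (2 * (q + 1)) * (q + 2) * (q + 1) ^ (b + m + r) := by gcongr; omega
    _ = 2 * ((q + 2) * (q + 1) ^ l') * (q + 1) ^ 2 := by rw [hl']; ring

end Counting

section Probability

open scoped ENNReal

/-- A set whose slices in the `j`-th coordinate have small measure is small. -/
lemma measure_pi_le_of_slices {ι : Type*} [Fintype ι] [DecidableEq ι] {X : ι → Type*}
    [∀ i, MeasurableSpace (X i)] (μ : ∀ i, Measure (X i)) [∀ i, IsProbabilityMeasure (μ i)]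
    {E : Set (∀ i, X i)} (hE : MeasurableSet E) (j : ι) {c : ℝ≥0∞}
    (h : ∀ w, μ j {g | Function.update w j g ∈ E} ≤ c) : Measure.pi μ E ≤ c := by
  have h1 : ∫⁻ w, E.indicator 1 w ∂Measure.pi μ ≤ ∫⁻ _, c ∂Measure.pi μ := by
    refine lintegral_le_of_lmarginal_le {j} (measurable_one.indicator hE) measurable_const ?_
    rw [lmarginal_singleton, lmarginal_singleton]
    intro w
    have hm : Measurable fun g => Function.update w j g := measurable_update w
    have h2 : ∀ g, E.indicator (1 : (∀ i, X i) → ℝ≥0∞) (Function.update w j g) =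
        ({g | Function.update w j g ∈ E} : Set (X j)).indicator 1 g := fun g => rfl
    simp only [h2, lintegral_const, measure_univ, mul_one]
    exact (lintegral_indicator_one (hm hE)).trans_le (h w)
  rwa [lintegral_indicator_one hE, lintegral_const, measure_univ, mul_one] at h1

variable {k : ℕ}

instance : DiscreteMeasurableSpace (FreeGroup (Fin k)) := ⟨fun _ => trivial⟩

/-- The measure of a set of words of the same length is proportional to its cardinality. -/
lemma measure_image_mk {ν : Measure (FreeGroup (Fin k))} {l : ℕ} {q : ℝ≥0∞}
    (hq : ∀ g, wlen g = l → ν {g} = q) {F : Finset (List (Fin k × Bool))}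
    (hF : F ⊆ reducedWords (Fin k) l) :
    ν {g | g.toWord ∈ F} = F.card * q := by
  classical
  have hmk : ∀ U ∈ F, (FreeGroup.mk U).toWord = U := fun U hU => by
    rw [FreeGroup.toWord_mk, (mem_reducedWords.1 (hF hU)).2.reduce_eq]
  have hset : {g : FreeGroup (Fin k) | g.toWord ∈ F} = ↑(F.image FreeGroup.mk) := by
    ext g
    simp only [Set.mem_ofPred_eq, Finset.coe_image, Set.mem_image, Finset.mem_coe]
    constructor
    · exact fun h => ⟨_, h, FreeGroup.mk_toWord⟩
    · rintro ⟨U, hU, rfl⟩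
      rwa [hmk U hU]
  rw [hset, ← sum_measure_singleton, Finset.sum_image, Finset.sum_congr rfl, Finset.sum_const,
    nsmul_eq_mul]
  · intro U hU
    exact hq _ (by rw [wlen, hmk U hU, (mem_reducedWords.1 (hF hU)).1])
  · intro U hU V hV h
    rw [← hmk U hU, ← hmk V hV, h]

/-- A radial probability measure gives small mass to a set of words which are determined by what is
outside a window of length `m`. -/
lemma measure_toWord_le [NeZero k] {ν : Measure (FreeGroup (Fin k))} [IsProbabilityMeasure ν]
    (hν : ∀ g g', wlen g = wlen g' → ν {g} = ν {g'}) {P : List (Fin k × Bool) → Prop} {b m : ℕ}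
    (hm : 0 < m) (hP : ∀ U, P U → b + m ≤ U.length)
    (hinj : ∀ U V, FreeGroup.IsReduced U → FreeGroup.IsReduced V → P U → P V →
      AgreeOutside b m U V → U = V) :
    ν {g | P g.toWord} ≤ 2 / (2 * k - 1 : ℕ) ^ m := by
  classical
  have hk : 0 < k := Nat.pos_of_ne_zero (NeZero.ne k)
  have hq0 : ((2 * k - 1 : ℕ) : ℝ≥0∞) ^ m ≠ 0 := by
    apply pow_ne_zero
    exact_mod_cast (by omega : 2 * k - 1 ≠ 0)
  rw [ENNReal.le_div_iff_mul_le (.inl hq0) (.inl (by finiteness))]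
  have hsum : ∀ S : Set (FreeGroup (Fin k)), ν S = ∑' l, ν (S ∩ {g | wlen g = l}) := by
    intro S
    rw [← measure_iUnion]
    · congr 1
      ext g
      simp
    · intro l l' hl
      refine Set.disjoint_left.2 fun g hg hg' => hl ?_
      rw [← hg.2, ← hg'.2]
    · exact fun _ => .of_discrete
  rw [hsum, ← ENNReal.tsum_mul_right]
  calc ∑' l, ν ({g | P g.toWord} ∩ {g | wlen g = l}) * ((2 * k - 1 : ℕ) : ℝ≥0∞) ^ m
      ≤ ∑' l, 2 * ν (Set.univ ∩ {g | wlen g = l}) := by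
        refine ENNReal.tsum_le_tsum fun l => ?_
        obtain ⟨q, hq⟩ : ∃ q, ∀ g, wlen g = l → ν {g} = q := by
          by_cases h : ∃ g : FreeGroup (Fin k), wlen g = l
          · obtain ⟨g₀, rfl⟩ := h
            exact ⟨_, fun g hg => hν g g₀ hg⟩
          · exact ⟨0, fun g hg => (h ⟨g, hg⟩).elim⟩
        have h1 : {g : FreeGroup (Fin k) | P g.toWord} ∩ {g | wlen g = l} =
            {g | g.toWord ∈ (reducedWords (Fin k) l).filter P} := by
          ext g
          simp [mem_reducedWords, FreeGroup.isReduced_toWord, wlen, and_comm]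
        have h2 : Set.univ ∩ {g : FreeGroup (Fin k) | wlen g = l} =
            {g | g.toWord ∈ reducedWords (Fin k) l} := by
          ext g
          simp [mem_reducedWords, FreeGroup.isReduced_toWord, wlen]
        rw [h1, h2, measure_image_mk hq (Finset.filter_subset _ _),
          measure_image_mk hq subset_rfl]
        have h3 : ((reducedWords (Fin k) l).filter P).card * (2 * k - 1) ^ m ≤
            2 * (reducedWords (Fin k) l).card := by
          rcases ((reducedWords (Fin k) l).filter P).eq_empty_or_nonempty with h | ⟨U, hU⟩
          · simp [h]
          · rw [Finset.mem_filter, mem_reducedWords] at hU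
            have h4 := card_mul_pow_le (F := (reducedWords (Fin k) l).filter P) hm
              (Finset.filter_subset _ _) ((hP U hU.2).trans hU.1.1.le) (fun U hU V hV h => by
                rw [Finset.mem_filter, mem_reducedWords] at hU hV
                exact hinj U V hU.1.2 hV.1.2 hU.2 hV.2 h)
            simpa using h4
        calc _ = ((((reducedWords (Fin k) l).filter P).card * (2 * k - 1) ^ m : ℕ) : ℝ≥0∞) * q := by
              push_cast; ring
          _ ≤ ((2 * (reducedWords (Fin k) l).card : ℕ) : ℝ≥0∞) * q := by gcongr
          _ = _ := by push_cast; ring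
    _ = 2 := by rw [ENNReal.tsum_mul_left, ← hsum, measure_univ, mul_one]

section Product

variable {p : ℕ} [NeZero k] (ν : Fin p → Measure (FreeGroup (Fin k)))
  [∀ i, IsProbabilityMeasure (ν i)]

lemma measure_sameAt_le
    (hν : ∀ i g g', wlen g = wlen g' → ν i {g} = ν i {g'})
    {m : ℕ} (hm : 0 < m) (i j : Fin p) (a b : ℕ)
    (hij : i ≠ j ∨ a < b) :
    Measure.pi ν {w | SameAt m a b (w i).toWord (w j).toWord} ≤ 2 / (2 * k - 1 : ℕ) ^ m := by
  refine measure_pi_le_of_slices ν .of_discrete j fun w => ?_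
  simp only [Set.mem_ofPred_eq, Function.update_self]
  by_cases h : i = j
  · subst h
    simp only [Function.update_self]
    exact measure_toWord_le (hν i) (P := fun U => SameAt m a b U U) hm (fun U hU => hU.2.1)
      fun U V _ _ hU hV => hU.eq_of_agreeOutside_self (by tauto) hV
  · simp only [Function.update_of_ne h]
    exact measure_toWord_le (hν j) (P := fun U => SameAt m a b (w i).toWord U) hm
      (fun U hU => hU.2.1) fun U V _ _ hU hV => hU.eq_of_agreeOutside hV

lemma measure_oppositeAt_le
    (hν : ∀ i g g', wlen g = wlen g' → ν i {g} = ν i {g'})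
    {m : ℕ} (hm : 0 < m) (i j : Fin p) (a b : ℕ) :
    Measure.pi ν {w | OppositeAt m a b (w i).toWord (w j).toWord} ≤
      2 / (2 * k - 1 : ℕ) ^ m := by
  refine measure_pi_le_of_slices ν .of_discrete j fun w => ?_
  simp only [Set.mem_ofPred_eq, Function.update_self]
  by_cases h : i = j
  · subst h
    simp only [Function.update_self]
    exact measure_toWord_le (hν i) (P := fun U => OppositeAt m a b U U) hm (fun U hU => hU.2.1)
      fun U V hUr _ hU hV => hU.eq_of_agreeOutside_self (hU.disjoint hUr hm) hV
  · simp only [Function.update_of_ne h]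
    exact measure_toWord_le (hν j) (P := fun U => OppositeAt m a b (w i).toWord U) hm
      (fun U hU => hU.2.1) fun U V _ _ hU hV => hU.eq_of_agreeOutside hV

/-- The probability that the subgroup is not malnormal, in terms of the lengths of the words. -/
lemma measure_not_malnormal_le
    (hν : ∀ i g g', wlen g = wlen g' → ν i {g} = ν i {g'})
    (hp : 1 ≤ p) (m N : ℕ) :
    Measure.pi ν {w | ¬ Malnormal (Subgroup.closure (Set.range w))} ≤
      ∑ i, ν i {g | ¬ 5 * m ≤ wlen g} + ∑ i, ν i {g | ¬ wlen g ≤ N} +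
        p ^ 2 * (N + 1) ^ 2 * (4 / (2 * k - 1 : ℕ) ^ m) := by
  rcases Nat.eq_zero_or_pos m with rfl | hm
  · refine prob_le_one.trans (le_add_left ?_)
    simp only [pow_zero, div_one]
    exact_mod_cast (Nat.mul_pos (Nat.mul_pos (pow_pos hp 2) (by positivity)) (by omega) :
      0 < p ^ 2 * (N + 1) ^ 2 * 4)
  set c : ℝ≥0∞ := 2 / (2 * k - 1 : ℕ) ^ m with hc
  let R := Finset.range (N + 1)
  let short : Set (Fin p → FreeGroup (Fin k)) := ⋃ i, {w | ¬ 5 * m ≤ wlen (w i)}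
  let long : Set (Fin p → FreeGroup (Fin k)) := ⋃ i, {w | ¬ wlen (w i) ≤ N}
  let bad (i j : Fin p) (a b : ℕ) : Set (Fin p → FreeGroup (Fin k)) :=
    {w | (i ≠ j ∨ a < b) ∧ SameAt m a b (w i).toWord (w j).toWord} ∪
      {w | OppositeAt m a b (w i).toWord (w j).toWord}
  have hbad : ∀ i j a b, Measure.pi ν (bad i j a b) ≤ 2 * c := fun i j a b => by
    rw [two_mul]
    refine (measure_union_le _ _).trans
      (add_le_add ?_ (measure_oppositeAt_le ν hν hm i j a b))
    by_cases hij : i ≠ j ∨ a < b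
    · simpa only [hij, true_and] using measure_sameAt_le ν hν hm i j a b hij
    · simp [hij]
  have hsub : {w | ¬ Malnormal (Subgroup.closure (Set.range w))} ⊆
      short ∪ long ∪ ⋃ i, ⋃ j, ⋃ a ∈ R, ⋃ b ∈ R, bad i j a b := by
    intro w hw
    by_contra hcon
    simp only [short, long, R, bad, Set.mem_union, Set.mem_iUnion, Set.mem_ofPred_eq,
      Finset.mem_range, exists_prop, not_or, not_exists, not_not, not_and] at hcon
    obtain ⟨⟨hshort, hlong⟩, hcon⟩ := hcon
    refine hw fun g ⟨x, hx1, hx, hgx⟩ =>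
      mem_closure_of_uniqueSubwords hm (uniqueSubwords_of ?_ ?_) hshort hx1 hx hgx
    · intro i j a b h
      have ha : a < N + 1 := by have := h.1; have := hlong i; rw [wlen] at this; omega
      have hb : b < N + 1 := by have := h.2.1; have := hlong j; rw [wlen] at this; omega
      have h1 := (hcon i j a ha b hb).1
      have h2 := (hcon j i b hb a ha).1
      by_contra hne
      by_cases hij : i = j
      · rcases Nat.lt_trichotomy a b with hab | hab | hab
        · exact h1 (.inr hab) h
        · exact hne ⟨hij, hab⟩
        · exact h2 (.inr hab) ⟨h.2.1, h.1, fun x hx => (h.2.2 x hx).symm⟩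
      · exact h1 (.inl hij) h
    · intro i j a b h
      have ha : a < N + 1 := by have := h.1; have := hlong i; rw [wlen] at this; omega
      have hb : b < N + 1 := by have := h.2.1; have := hlong j; rw [wlen] at this; omega
      exact (hcon i j a ha b hb).2 h
  have heval : ∀ i (S : Set (FreeGroup (Fin k))), Measure.pi ν {w | w i ∈ S} = ν i S :=
    fun i S => (measurePreserving_eval ν i).measure_preimage
      (MeasurableSet.of_discrete (s := S)).nullMeasurableSet
  refine (measure_mono hsub).trans ((measure_union_le _ _).trans (add_le_add
    ((measure_union_le _ _).trans (add_le_add ?_ ?_)) ?_))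
  · refine (measure_iUnion_fintype_le _ _).trans (Finset.sum_le_sum fun i _ => ?_)
    exact (heval i {g | ¬ 5 * m ≤ wlen g}).le
  · refine (measure_iUnion_fintype_le _ _).trans (Finset.sum_le_sum fun i _ => ?_)
    exact (heval i {g | ¬ wlen g ≤ N}).le
  · calc Measure.pi ν (⋃ i, ⋃ j, ⋃ a ∈ R, ⋃ b ∈ R, bad i j a b)
        ≤ ∑ _i : Fin p, ∑ _j : Fin p, ∑ _a ∈ R, ∑ _b ∈ R, 2 * c := by
          refine (measure_iUnion_fintype_le _ _).trans (Finset.sum_le_sum fun i _ => ?_)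
          refine (measure_iUnion_fintype_le _ _).trans (Finset.sum_le_sum fun j _ => ?_)
          refine (measure_biUnion_finset_le _ _).trans (Finset.sum_le_sum fun a _ => ?_)
          refine (measure_biUnion_finset_le _ _).trans (Finset.sum_le_sum fun b _ => ?_)
          exact hbad i j a b
      _ = p ^ 2 * (N + 1) ^ 2 * (4 / (2 * k - 1 : ℕ) ^ m) := by
          simp only [Finset.sum_const, Finset.card_univ, Fintype.card_fin, R, Finset.card_range,
            nsmul_eq_mul, hc, div_eq_mul_inv]
          push_cast
          ring

end Product

end Probability

section Decay

open scoped ENNReal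

lemma ExpDecay.mono {f g : ℕ → ℝ≥0∞} (hg : ExpDecay g) (h : ∀ n, f n ≤ g n) : ExpDecay f := by
  obtain ⟨C, hC, κ, hκ, hb⟩ := hg
  exact ⟨C, hC, κ, hκ, fun n => (h n).trans (hb n)⟩

lemma ExpDecay.add {f g : ℕ → ℝ≥0∞} (hf : ExpDecay f) (hg : ExpDecay g) :
    ExpDecay fun n => f n + g n := by
  obtain ⟨C, hC, κ, hκ, hb⟩ := hf
  obtain ⟨C', hC', κ', hκ', hb'⟩ := hg
  have hmin : 1 < min κ κ' := lt_min hκ hκ'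
  refine ⟨C + C', by positivity, min κ κ', hmin, fun n => ?_⟩
  refine (add_le_add (hb n) (hb' n)).trans ?_
  rw [← ENNReal.ofReal_add (by positivity) (by positivity), add_div]
  gcongr
  · exact min_le_left _ _
  · exact min_le_right _ _

lemma ExpDecay.sum {ι : Type*} (s : Finset ι) {f : ι → ℕ → ℝ≥0∞} (hf : ∀ i, ExpDecay (f i)) :
    ExpDecay fun n => ∑ i ∈ s, f i n := by
  classical
  induction s using Finset.induction_on with
  | empty => exact ⟨1, one_pos, 2, one_lt_two, fun n => by simp⟩
  | insert i s hi ih =>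
    simp only [Finset.sum_insert hi]
    exact (hf i).add ih

/-- Exponentially long words have few coincidences of linear length. -/
lemma expDecay_coincidences {k p : ℕ} (hk : 2 ≤ k) (hp : 1 ≤ p) {L : ℝ} (hL : 0 < L) :
    ExpDecay fun n => p ^ 2 * ((⌊Real.exp (Real.log 3 * L / 20 * n)⌋₊ : ℝ≥0∞) + 1) ^ 2 *
      (4 / (2 * k - 1 : ℕ) ^ ⌊L * n / 5⌋₊) := by
  have hlog : 0 < Real.log 3 := Real.log_pos (by norm_num)
  have hp' : (0 : ℝ) < p := by exact_mod_cast hp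
  refine ⟨48 * p ^ 2, by positivity, Real.exp (Real.log 3 * L / 10),
    Real.one_lt_exp_iff.2 (by positivity), fun n => ?_⟩
  set E := Real.exp (Real.log 3 * L / 20 * n) with hE
  set m := ⌊L * n / 5⌋₊ with hm
  have hE1 : 1 ≤ E := Real.one_le_exp (by positivity)
  have hpow : E ^ 4 ≤ 3 * ((2 * k - 1 : ℕ) : ℝ) ^ m := by
    calc E ^ 4 = Real.exp (Real.log 3 * (L * n / 5)) := by
          rw [hE, ← Real.exp_nat_mul]; congr 1; push_cast; ring
      _ ≤ Real.exp (Real.log 3 * (m + 1)) := by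
          gcongr; exact (Nat.lt_floor_add_one _).le
      _ = 3 * 3 ^ m := by
          rw [mul_add, Real.exp_add, mul_one, mul_comm (Real.log 3), Real.exp_nat_mul,
            Real.exp_log (by norm_num)]
          ring
      _ ≤ 3 * ((2 * k - 1 : ℕ) : ℝ) ^ m := by
          gcongr
          exact_mod_cast (by omega : 3 ≤ 2 * k - 1)
  have hk0 : (0 : ℝ) < ((2 * k - 1 : ℕ) : ℝ) := by exact_mod_cast (by omega : 0 < 2 * k - 1)
  have hfl : (⌊E⌋₊ : ℝ) ≤ E := Nat.floor_le (by positivity)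
  have hconv : (p : ℝ≥0∞) ^ 2 * ((⌊E⌋₊ : ℝ≥0∞) + 1) ^ 2 * (4 / (2 * k - 1 : ℕ) ^ m) =
      ENNReal.ofReal ((p : ℝ) ^ 2 * ((⌊E⌋₊ : ℝ) + 1) ^ 2 * (4 / ((2 * k - 1 : ℕ) : ℝ) ^ m)) := by
    rw [ENNReal.ofReal_mul (by positivity), ENNReal.ofReal_mul (by positivity),
      ENNReal.ofReal_div_of_pos (by positivity), ENNReal.ofReal_pow (by positivity),
      ENNReal.ofReal_pow (by positivity), ENNReal.ofReal_pow (by positivity),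
      ENNReal.ofReal_add (by positivity) (by positivity)]
    simp only [ENNReal.ofReal_natCast, ENNReal.ofReal_one, ENNReal.ofReal_ofNat]
  refine hconv.trans_le (ENNReal.ofReal_le_ofReal ?_)
  have hκ : Real.exp (Real.log 3 * L / 10) ^ n = E ^ 2 := by
    rw [hE, ← Real.exp_nat_mul, ← Real.exp_nat_mul]; congr 1; push_cast; ring
  rw [hκ, mul_div_assoc', div_le_div_iff₀ (by positivity) (by positivity)]
  calc (p : ℝ) ^ 2 * ((⌊E⌋₊ : ℝ) + 1) ^ 2 * 4 * E ^ 2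
      ≤ (p : ℝ) ^ 2 * (E + E) ^ 2 * 4 * E ^ 2 := by gcongr
    _ = 16 * p ^ 2 * E ^ 4 := by ring
    _ ≤ 16 * p ^ 2 * (3 * ((2 * k - 1 : ℕ) : ℝ) ^ m) := by gcongr
    _ = 48 * p ^ 2 * ((2 * k - 1 : ℕ) : ℝ) ^ m := by ring

end Decay

/-- `μ n i` is the distribution of `w_{i,n}`; independence is expressed
by the product measure. Under radial symmetry, positive drift and subexponential growth,
with probability going to 1 exponentially fast the subgroup `H = ⟨w_{1,n}, …, w_{p,n}⟩`
is malnormal in `F_k`. -/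
theorem random_subgroup_malnormal (k p : ℕ) (hk : 2 ≤ k) (hp : 1 ≤ p)
    (μ : ℕ → Fin p → Measure (FreeGroup (Fin k)))
    (hprob : ∀ n i, IsProbabilityMeasure (μ n i))
    (hradial : ∀ n i (g g' : FreeGroup (Fin k)), wlen g = wlen g' →
      μ n i {g} = μ n i {g'})
    (L : ℝ) (hL : 0 < L)
    (hdrift : ∀ i, ExpDecay (fun n => μ n i {g | ¬ (L * n < (wlen g : ℝ))}))
    (hsubexp : ∀ θ : ℝ, 0 < θ → ∀ i,
      ExpDecay (fun n => μ n i {g | ¬ ((wlen g : ℝ) ≤ Real.exp (θ * n))})) :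
    ExpDecay (fun n =>
      Measure.pi (μ n)
        {w : Fin p → FreeGroup (Fin k) |
          ¬ Malnormal (Subgroup.closure (Set.range w))}) := by
  have : NeZero k := ⟨by omega⟩
  have hθ : 0 < Real.log 3 * L / 20 := by
    have : 0 < Real.log 3 := Real.log_pos (by norm_num)
    positivity
  refine (((ExpDecay.sum Finset.univ hdrift).add
    (ExpDecay.sum Finset.univ (hsubexp _ hθ))).add (expDecay_coincidences hk hp hL)).mono
    fun n => ?_
  refine (measure_not_malnormal_le (μ n) (hradial n) hp ⌊L * n / 5⌋₊
    ⌊Real.exp (Real.log 3 * L / 20 * n)⌋₊).trans ?_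
  gcongr with i _ g i _ g
  · intro h
    have h1 : (⌊L * n / 5⌋₊ : ℝ) ≤ L * n / 5 := Nat.floor_le (by positivity)
    exact_mod_cast (by push_cast; linarith : ((5 * ⌊L * n / 5⌋₊ : ℕ) : ℝ) ≤ wlen g)
  · exact fun h => Nat.le_floor h

end
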